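/- Let q be a real number with 0 < q < 1, let α, β be real numbers with α > -1 and β > -1, and let N be a positive integer. Let A be the 2N×2N skew-symmetric matrix with entries a_{i,j} = ([j]_q - [i]_q) (1-q) (q^{α+2};q)_{i+j-1} / (q^{α+β+4};q)_{i+j-1} for 0 ≤ i, j ≤ 2N-1 (diagonal entries 0). Then Pf(A) = q^{N(N-1)(4N+1)/3 + α N(N-1)} ∏_{k=0}^{N-1} (q;q)_{2k+1} (q^{α+2};q)_{2k} (q^{β+2};q)_{2k} / ( (q^{α+β+4};q)_{2k-2} (q^{α+β+2k+2};q)_{2k} (q^{α+β+2k+2};q)_{2k+2} ), where for k = 0 the symbol (q^{α+β+4};q)_{-2} = 1/((q^{α+β+2};q)_2). (This is the Catalan–Hankel Pfaffian evaluation attached to the little q-Jacobi weight.) -/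

import Mathlib

open scoped BigOperators

/-- The finite q-Pochhammer symbol `(a;q)_n = ∏_{k=0}^{n-1} (1 - a q^k)`. -/
noncomputable def qPoch (a q : ℝ) (n : ℕ) : ℝ := ∏ k ∈ Finset.range n, (1 - a * q ^ k)

/-- The q-bracket `[j]_q = (1 - q^j)/(1 - q)`. -/
noncomputable def qBracket (q : ℝ) (j : ℕ) : ℝ := (1 - q ^ j) / (1 - q)

/-- The Pfaffian of a `2N × 2N` real matrix, defined by
`Pf(A) = (1/(2^N N!)) ∑_{σ ∈ S_{2N}} sgn(σ) ∏_{k=1}^{N} a_{σ(2k-1),σ(2k)}`. -/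
noncomputable def pfaffian {N : ℕ} (A : Matrix (Fin (2 * N)) (Fin (2 * N)) ℝ) : ℝ :=
  (1 / (2 ^ N * (Nat.factorial N : ℝ))) *
    ∑ σ : Equiv.Perm (Fin (2 * N)),
      ((Equiv.Perm.sign σ : ℤ) : ℝ) *
        ∏ k : Fin N,
          A (σ ⟨2 * (k : ℕ), by have := k.isLt; omega⟩)
            (σ ⟨2 * (k : ℕ) + 1, by have := k.isLt; omega⟩)

/-- The Pfaffian sum over all permutations, without the factor `1 / (2 ^ N * N !)`, for matrices
indexed by a type of pairs. -/
noncomputable def pfSum {ι : Type*} [Fintype ι] [DecidableEq ι]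
    (A : Matrix (ι × Fin 2) (ι × Fin 2) ℝ) : ℝ :=
  ∑ σ : Equiv.Perm (ι × Fin 2), ((Equiv.Perm.sign σ : ℤ) : ℝ) * ∏ k, A (σ (k, 0)) (σ (k, 1))

theorem pfSum_congr_mul {ι : Type*} [Fintype ι] [DecidableEq ι]
    (A B : Matrix (ι × Fin 2) (ι × Fin 2) ℝ) :
    pfSum (B * A * B.transpose) = B.det * pfSum A := by
  have expand : pfSum (B * A * B.transpose) =
      ∑ f : ι × Fin 2 → ι × Fin 2,
        (B.submatrix id f).det * ∏ k, A (f (k, 0)) (f (k, 1)) := by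
    have entry (x y : ι × Fin 2) : (B * A * B.transpose) x y =
        ∑ u : Fin 2 → ι × Fin 2, B x (u 0) * B y (u 1) * A (u 0) (u 1) := by
      rw [← (finTwoArrowEquiv (ι × Fin 2)).symm.sum_comp, Fintype.sum_prod_type_right]
      simp only [Matrix.mul_apply, Matrix.transpose_apply, Finset.sum_mul]
      refine Finset.sum_congr rfl fun p _ => Finset.sum_congr rfl fun r _ => ?_
      simp only [finTwoArrowEquiv_symm_apply, Matrix.cons_val_zero, Matrix.cons_val_one]
      ring
    simp only [pfSum, entry, Finset.prod_univ_sum, Fintype.piFinset_univ, Finset.mul_sum]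
    rw [Finset.sum_comm, ← (Equiv.curry ι (Fin 2) (ι × Fin 2)).sum_comp]
    refine Finset.sum_congr rfl fun f _ => ?_
    rw [Matrix.det_apply', Finset.sum_mul]
    refine Finset.sum_congr rfl fun σ _ => ?_
    simp only [Equiv.curry_apply, Function.curry_apply, Finset.prod_mul_distrib,
      Matrix.submatrix_apply, id_eq, Fintype.prod_prod_type, Fin.prod_univ_two]
    ring
  rw [expand, pfSum, Finset.mul_sum]
  symm
  refine Finset.sum_of_injOn (fun σ : Equiv.Perm (ι × Fin 2) => (σ : ι × Fin 2 → ι × Fin 2))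
    DFunLike.coe_injective.injOn (fun _ _ => Finset.mem_coe.2 (Finset.mem_univ _)) ?_ ?_
  · intro f _ hf
    have hinj : ¬ Function.Injective f := fun h =>
      hf ⟨Equiv.ofBijective f (Finite.injective_iff_bijective.1 h),
        Finset.mem_coe.2 (Finset.mem_univ _), rfl⟩
    simp only [Function.Injective, not_forall] at hinj
    obtain ⟨x, y, hxy, hne⟩ := hinj
    rw [Matrix.det_zero_of_column_eq hne (fun i => by simp [hxy]), zero_mul]
  · intro σ _
    rw [Matrix.det_permute']
    ring

theorem pfSum_eq_of_matching {ι : Type*} [Fintype ι] [DecidableEq ι]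
    (A : Matrix (ι × Fin 2) (ι × Fin 2) ℝ) (skew : ∀ x y, A y x = -A x y)
    (matching : ∀ σ : Equiv.Perm (ι × Fin 2), (∀ k, A (σ (k, 0)) (σ (k, 1)) ≠ 0) →
      ∀ k, (σ (k, 0)).1 = (σ (k, 1)).1) :
    pfSum A = 2 ^ Fintype.card ι * (Fintype.card ι).factorial * ∏ k, A (k, 0) (k, 1) := by
  let Φ : Equiv.Perm ι × (ι → Equiv.Perm (Fin 2)) → Equiv.Perm (ι × Fin 2) := fun p =>
    Equiv.prodCongrLeft (fun _ => p.1) * Equiv.prodCongrRight p.2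
  have Φ_apply (p) (k : ι) (s : Fin 2) : Φ p (k, s) = (p.1 k, p.2 k s) := rfl
  have Φ_sign (p) : Equiv.Perm.sign (Φ p) = ∏ k, Equiv.Perm.sign (p.2 k) := by
    simp [Φ, Equiv.Perm.sign_prodCongrLeft, Equiv.Perm.sign_prodCongrRight]
  have flip (i : ι) (τ : Equiv.Perm (Fin 2)) :
      ((Equiv.Perm.sign τ : ℤ) : ℝ) * A (i, τ 0) (i, τ 1) = A (i, 0) (i, 1) := by
    have h : τ = 1 ∨ τ = Equiv.swap 0 1 := by revert τ; decide
    rcases h with rfl | rfl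
    · simp
    · simp [skew (i, 0) (i, 1)]
  have card : (2 : ℝ) ^ Fintype.card ι * (Fintype.card ι).factorial * ∏ k, A (k, 0) (k, 1) =
      ∑ _p : Equiv.Perm ι × (ι → Equiv.Perm (Fin 2)), ∏ k, A (k, 0) (k, 1) := by
    simp [Fintype.card_perm]
    exact Or.inl (mul_comm _ _)
  rw [card, pfSum]
  symm
  refine Finset.sum_of_injOn Φ ?_ (fun _ _ => Finset.mem_coe.2 (Finset.mem_univ _)) ?_ ?_
  · rintro ⟨π, τ⟩ _ ⟨π', τ'⟩ _ h
    have h' (k : ι) (s : Fin 2) : π k = π' k ∧ τ k s = τ' k s := by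
      have := congrArg (fun σ : Equiv.Perm (ι × Fin 2) => σ (k, s)) h
      simpa [Φ_apply] using this
    exact Prod.ext (Equiv.ext fun k => (h' k 0).1) (funext fun k => Equiv.ext fun s => (h' k s).2)
  · intro σ _ hσ
    by_contra hne
    refine hσ ?_
    have hA : ∀ k, A (σ (k, 0)) (σ (k, 1)) ≠ 0 := fun k =>
      Finset.prod_ne_zero_iff.1 (right_ne_zero_of_mul hne) k (Finset.mem_univ k)
    have hm := matching σ hA
    have hfst (k : ι) (s : Fin 2) : (σ (k, s)).1 = (σ (k, 0)).1 := by
      fin_cases s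
      · rfl
      · exact (hm k).symm
    have hsnd (k : ι) : Function.Injective fun s => (σ (k, s)).2 := by
      intro s t hst
      have := σ.injective (Prod.ext ((hfst k s).trans (hfst k t).symm) hst)
      exact (Prod.ext_iff.1 this).2
    have hsurj : Function.Surjective fun k => (σ (k, 0)).1 := by
      intro i
      refine ⟨(σ.symm (i, 0)).1, ?_⟩
      have := hfst (σ.symm (i, 0)).1 (σ.symm (i, 0)).2
      simpa using this.symm
    refine ⟨(Equiv.ofBijective _ (Finite.surjective_iff_bijective.1 hsurj),
      fun k => Equiv.ofBijective _ (Finite.injective_iff_bijective.1 (hsnd k))),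
      Finset.mem_coe.2 (Finset.mem_univ _), Equiv.ext ?_⟩
    rintro ⟨k, s⟩
    rw [Φ_apply]
    exact Prod.ext (hfst k s).symm rfl
  · rintro ⟨π, τ⟩ _
    rw [Φ_sign, ← Equiv.prod_comp π]
    push_cast
    rw [← Finset.prod_mul_distrib]
    exact Finset.prod_congr rfl fun k _ => (flip (π k) (τ k)).symm

theorem pfSum_of_tridiagonal {N : ℕ}
    (A : Matrix (Fin N × Fin 2) (Fin N × Fin 2) ℝ) (skew : ∀ x y, A y x = -A x y)
    (tri : ∀ x y : Fin N × Fin 2, 2 * (x.1 : ℕ) + x.2 + 1 < 2 * (y.1 : ℕ) + y.2 → A x y = 0) :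
    pfSum A = 2 ^ N * N.factorial * ∏ k, A (k, 0) (k, 1) := by
  have diag (x) : A x x = 0 := by linarith [skew x x]
  let w : Fin N × Fin 2 → ℤ := fun x => if x.2 = 0 then -(x.1 : ℤ) else x.1
  have adjacent (x y) (h : A x y ≠ 0) : w x + w y ≤ 0 ∧ (w x + w y = 0 → x.1 = y.1) := by
    have h1 := mt (tri x y) h
    have h2 := mt (tri y x) (by rw [skew]; exact neg_ne_zero.2 h)
    have h3 : x ≠ y := by rintro rfl; exact h (diag x)
    obtain ⟨i, s⟩ := x
    obtain ⟨j, t⟩ := y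
    fin_cases s <;> fin_cases t <;>
      simp only [w, Fin.ext_iff, ne_eq, Prod.mk.injEq, Fin.zero_eta, Fin.mk_one, Fin.isValue, Fin.val_zero,
        Fin.val_one, if_true, one_ne_zero, if_false, and_true] at h1 h2 h3 ⊢ <;> omega
  have key := pfSum_eq_of_matching A skew fun σ hσ => by
    have total : ∑ k, (w (σ (k, 0)) + w (σ (k, 1))) = 0 := by
      have h1 := Equiv.sum_comp σ w
      rw [Fintype.sum_prod_type, Fintype.sum_prod_type] at h1
      simp only [Fin.sum_univ_two] at h1
      rw [h1]
      simp [w]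
    have hz := (Finset.sum_eq_zero_iff_of_nonpos
      fun k _ => (adjacent _ _ (hσ k)).1).1 total
    exact fun k => (adjacent _ _ (hσ k)).2 (hz k (Finset.mem_univ k))
  simpa using key

/-- The identification of `Fin N × Fin 2` with `Fin (2 * N)` sending `(k, s)` to `2 * k + s`. -/
def pairEquiv (N : ℕ) : Fin N × Fin 2 ≃ Fin (2 * N) :=
  finProdFinEquiv.trans (finCongr (Nat.mul_comm N 2))

theorem pairEquiv_val {N : ℕ} (k : Fin N) (s : Fin 2) :
    (pairEquiv N (k, s) : ℕ) = 2 * (k : ℕ) + s := by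
  simp [pairEquiv, finProdFinEquiv, add_comm]

theorem pfaffian_eq_pfSum {N : ℕ} (A : Matrix (Fin (2 * N)) (Fin (2 * N)) ℝ) :
    pfaffian A = 1 / (2 ^ N * (N.factorial : ℝ)) *
      pfSum (A.submatrix (pairEquiv N) (pairEquiv N)) := by
  rw [pfaffian, pfSum]
  congr 1
  refine Fintype.sum_equiv (pairEquiv N).symm.permCongr _ _ fun σ => ?_
  rw [Equiv.Perm.sign_permCongr]
  congr 1
  refine Finset.prod_congr rfl fun k _ => ?_
  have h0 : pairEquiv N (k, 0) = ⟨2 * (k : ℕ), by have := k.isLt; omega⟩ :=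
    Fin.ext (pairEquiv_val k 0)
  have h1 : pairEquiv N (k, 1) = ⟨2 * (k : ℕ) + 1, by have := k.isLt; omega⟩ :=
    Fin.ext (pairEquiv_val k 1)
  simp [Equiv.permCongr_apply, h0, h1]

/-- If `B * A * Bᵀ` is skew-symmetric and tridiagonal, then the Pfaffian of `A` is determined
by the entries of `B * A * Bᵀ` just above the diagonal. -/
theorem det_mul_pfaffian_of_tridiagonal {N : ℕ} (A B : Matrix (Fin (2 * N)) (Fin (2 * N)) ℝ)
    (g : ℕ → ℕ → ℝ) (hg : ∀ i j, ∑ r, (∑ p, B i p * A p r) * B j r = g i j)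
    (skew : ∀ i j, g j i = -g i j) (tri : ∀ i j, i + 1 < j → g i j = 0) :
    B.det * pfaffian A = ∏ k ∈ Finset.range N, g (2 * k) (2 * k + 1) := by
  have hg' (i j) : (B * A * B.transpose) i j = g i j := by
    simpa only [Matrix.mul_apply, Matrix.transpose_apply] using hg i j
  let e := pairEquiv N
  have h := pfSum_congr_mul (A.submatrix e e) (B.submatrix e e)
  rw [Matrix.transpose_submatrix, Matrix.submatrix_mul_equiv, Matrix.submatrix_mul_equiv,
    Matrix.det_submatrix_equiv_self, pfSum_of_tridiagonal] at h
  · rw [pfaffian_eq_pfSum, mul_left_comm, ← h, ← mul_assoc, one_div,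
      inv_mul_cancel₀ (by positivity), one_mul, Finset.prod_range]
    refine Finset.prod_congr rfl fun k _ => ?_
    rw [Matrix.submatrix_apply, hg', pairEquiv_val, pairEquiv_val]
    simp
  · intro x y
    simp only [Matrix.submatrix_apply, hg']
    exact skew _ _
  · rintro ⟨i, s⟩ ⟨j, t⟩ hxy
    simp only [Matrix.submatrix_apply, hg']
    refine tri _ _ ?_
    rw [pairEquiv_val, pairEquiv_val]
    exact hxy

theorem qPoch_zero (x q : ℝ) : qPoch x q 0 = 1 := by simp [qPoch]

theorem qPoch_succ (x q : ℝ) (n : ℕ) : qPoch x q (n + 1) = qPoch x q n * (1 - x * q ^ n) :=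
  Finset.prod_range_succ _ _

theorem qPoch_succ' (x q : ℝ) (n : ℕ) : qPoch x q (n + 1) = (1 - x) * qPoch (x * q) q n := by
  rw [qPoch, Finset.prod_range_succ', mul_comm, pow_zero, mul_one, qPoch]
  congr 1
  exact Finset.prod_congr rfl fun k _ => by ring

theorem qPoch_add (x q : ℝ) (m n : ℕ) :
    qPoch x q (m + n) = qPoch x q m * qPoch (x * q ^ m) q n := by
  rw [qPoch, Finset.prod_range_add, qPoch, qPoch]
  congr 1
  exact Finset.prod_congr rfl fun k _ => by ring

theorem qPoch_pos {x q : ℝ} (hx : x < 1) (hq0 : 0 < q) (hq1 : q < 1) (n : ℕ) :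
    0 < qPoch x q n := by
  refine Finset.prod_pos fun k _ => ?_
  have h0 : 0 < q ^ k := pow_pos hq0 k
  have h1 : q ^ k ≤ 1 := pow_le_one₀ hq0.le hq1.le
  nlinarith

namespace LittleQJacobi

open Polynomial

/-- The parameters of a little q-Jacobi weight, with `a = q ^ α` and `b = q ^ β`. -/
structure Admissible (q a b : ℝ) : Prop where
  q_pos : 0 < q
  q_lt_one : q < 1
  a_pos : 0 < a
  b_pos : 0 < b
  aq_lt_one : a * q < 1
  bq_lt_one : b * q < 1

theorem Admissible.shift {q a b : ℝ} (h : Admissible q a b) :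
    Admissible q (a * q) (b * q) := by
  obtain ⟨hq, hq1, ha, hb, haq, hbq⟩ := h
  exact ⟨hq, hq1, by positivity, by positivity, by nlinarith, by nlinarith⟩

theorem Admissible.abq_lt_one {q a b : ℝ} (h : Admissible q a b) (n : ℕ) :
    a * b * q ^ (n + 2) < 1 := by
  obtain ⟨hq, hq1, ha, hb, haq, hbq⟩ := h
  have h0 : 0 < q ^ n := pow_pos hq n
  have h1 : q ^ n ≤ 1 := pow_le_one₀ hq.le hq1.le
  have h2 : (a * q) * (b * q) < 1 := mul_lt_one_of_nonneg_of_lt_one_left (by positivity) haq hbq.le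
  calc a * b * q ^ (n + 2) = (a * q) * (b * q) * q ^ n := by ring
    _ ≤ (a * q) * (b * q) := mul_le_of_le_one_right (by positivity) h1
    _ < 1 := h2

/-- The normalised little q-Jacobi moment functional. -/
noncomputable def functional (q a b : ℝ) : ℝ[X] →ₗ[ℝ] ℝ :=
  (basisMonomials ℝ).constr ℝ fun n => qPoch (a * q) q n / qPoch (a * b * q ^ 2) q n

/-- The operator `f(x) ↦ (1 - b q x) f(q x) - (a q)⁻¹ (1 - x) f(x / q)`, which intertwines the
functional with the skew-symmetric form. -/
noncomputable def skewOperator (q a b : ℝ) : ℝ[X] →ₗ[ℝ] ℝ[X] :=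
  (basisMonomials ℝ).constr ℝ fun i =>
    C (q ^ i - (a * q ^ (i + 1))⁻¹) * X ^ i + C ((a * q ^ (i + 1))⁻¹ - b * q ^ (i + 1)) * X ^ (i + 1)

/-- The raising operator `f(x) ↦ (1 - b q x) f(x) - (a q)⁻¹ (1 - x) f(x / q)`. -/
noncomputable def raising (q a b : ℝ) : ℝ[X] →ₗ[ℝ] ℝ[X] :=
  (basisMonomials ℝ).constr ℝ fun i =>
    C (1 - (a * q ^ (i + 1))⁻¹) * X ^ i + C ((a * q ^ (i + 1))⁻¹ - b * q) * X ^ (i + 1)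

/-- The little q-Jacobi polynomials, generated by the raising operators. -/
noncomputable def poly (q : ℝ) : ℕ → ℝ → ℝ → ℝ[X]
  | 0, _, _ => 1
  | n + 1, a, b => raising q a b (poly q n (a * q) (b * q))

theorem X_pow_eq_basisMonomials (n : ℕ) : (X ^ n : ℝ[X]) = basisMonomials ℝ n := by
  simp [X_pow_eq_monomial]

theorem functional_X_pow (q a b : ℝ) (n : ℕ) :
    functional q a b (X ^ n) = qPoch (a * q) q n / qPoch (a * b * q ^ 2) q n := by
  rw [X_pow_eq_basisMonomials]
  exact (basisMonomials ℝ).constr_basis ℝ _ n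

theorem skewOperator_X_pow (q a b : ℝ) (i : ℕ) : skewOperator q a b (X ^ i) =
    C (q ^ i - (a * q ^ (i + 1))⁻¹) * X ^ i +
      C ((a * q ^ (i + 1))⁻¹ - b * q ^ (i + 1)) * X ^ (i + 1) := by
  conv_lhs => rw [X_pow_eq_basisMonomials]
  exact (basisMonomials ℝ).constr_basis ℝ _ i

theorem raising_X_pow (q a b : ℝ) (i : ℕ) : raising q a b (X ^ i) =
    C (1 - (a * q ^ (i + 1))⁻¹) * X ^ i + C ((a * q ^ (i + 1))⁻¹ - b * q) * X ^ (i + 1) := by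
  conv_lhs => rw [X_pow_eq_basisMonomials]
  exact (basisMonomials ℝ).constr_basis ℝ _ i

theorem functional_C_mul (q a b c : ℝ) (f : ℝ[X]) :
    functional q a b (C c * f) = c * functional q a b f := by
  rw [C_mul', map_smul, smul_eq_mul]

theorem linearMap_ext_X_pow {M : Type*} [AddCommMonoid M] [Module ℝ M] {S T : ℝ[X] →ₗ[ℝ] M}
    (h : ∀ i, S (X ^ i) = T (X ^ i)) : S = T :=
  (basisMonomials ℝ).ext fun i => by simpa [X_pow_eq_monomial] using h i

theorem coeff_skewOperator (q a b : ℝ) (f : ℝ[X]) (k : ℕ) :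
    (skewOperator q a b f).coeff (k + 1) =
      (q ^ (k + 1) - (a * q ^ (k + 2))⁻¹) * f.coeff (k + 1) +
        ((a * q ^ (k + 1))⁻¹ - b * q ^ (k + 1)) * f.coeff k := by
  suffices h : lcoeff ℝ (k + 1) ∘ₗ skewOperator q a b =
      (q ^ (k + 1) - (a * q ^ (k + 2))⁻¹) • lcoeff ℝ (k + 1) +
        ((a * q ^ (k + 1))⁻¹ - b * q ^ (k + 1)) • lcoeff ℝ k from LinearMap.congr_fun h f
  refine linearMap_ext_X_pow fun i => ?_
  simp only [LinearMap.comp_apply, skewOperator_X_pow, lcoeff_apply, LinearMap.add_apply,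
    LinearMap.smul_apply, coeff_add, coeff_C_mul, coeff_X_pow, smul_eq_mul, add_left_inj]
  congr 1
  · split_ifs with h
    · subst h; rfl
    · simp
  · split_ifs with h
    · subst h; rfl
    · simp

theorem coeff_raising (q a b : ℝ) (f : ℝ[X]) (k : ℕ) :
    (raising q a b f).coeff (k + 1) =
      (1 - (a * q ^ (k + 2))⁻¹) * f.coeff (k + 1) +
        ((a * q ^ (k + 1))⁻¹ - b * q) * f.coeff k := by
  suffices h : lcoeff ℝ (k + 1) ∘ₗ raising q a b =
      (1 - (a * q ^ (k + 2))⁻¹) • lcoeff ℝ (k + 1) +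
        ((a * q ^ (k + 1))⁻¹ - b * q) • lcoeff ℝ k from LinearMap.congr_fun h f
  refine linearMap_ext_X_pow fun i => ?_
  simp only [LinearMap.comp_apply, raising_X_pow, lcoeff_apply, LinearMap.add_apply,
    LinearMap.smul_apply, coeff_add, coeff_C_mul, coeff_X_pow, smul_eq_mul, add_left_inj]
  congr 1
  · split_ifs with h
    · subst h; rfl
    · simp
  · split_ifs with h
    · subst h; rfl
    · simp

theorem natDegree_skewOperator_le (q a b : ℝ) (f : ℝ[X]) :
    (skewOperator q a b f).natDegree ≤ f.natDegree + 1 := by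
  refine natDegree_le_iff_coeff_eq_zero.2 fun k hk => ?_
  obtain ⟨k, rfl⟩ := Nat.exists_eq_succ_of_ne_zero (Nat.ne_zero_of_lt hk)
  rw [Nat.succ_eq_add_one, coeff_skewOperator, coeff_eq_zero_of_natDegree_lt (by omega),
    coeff_eq_zero_of_natDegree_lt (by omega), mul_zero, mul_zero, add_zero]

theorem natDegree_poly_le (q : ℝ) (n : ℕ) (a b : ℝ) : (poly q n a b).natDegree ≤ n := by
  induction n generalizing a b with
  | zero => simp [poly]
  | succ n ih =>
    refine natDegree_le_iff_coeff_eq_zero.2 fun k hk => ?_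
    obtain ⟨k, rfl⟩ := Nat.exists_eq_succ_of_ne_zero (Nat.ne_zero_of_lt hk)
    have hn := ih (a * q) (b * q)
    rw [Nat.succ_eq_add_one, poly, coeff_raising, coeff_eq_zero_of_natDegree_lt (by omega),
      coeff_eq_zero_of_natDegree_lt (by omega), mul_zero, mul_zero, add_zero]

theorem coeff_poly_self {q a b : ℝ} (h : Admissible q a b) (n : ℕ) :
    (poly q n a b).coeff n = qPoch (a * b * q ^ (n + 1)) q n / (a * q ^ n) ^ n := by
  induction n generalizing a b with
  | zero => simp [poly, qPoch_zero]
  | succ n ih =>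
    have hn := natDegree_poly_le q n (a * q) (b * q)
    have hq := h.q_pos.ne'
    have ha := h.a_pos.ne'
    rw [poly, coeff_raising, coeff_eq_zero_of_natDegree_lt (by omega), ih h.shift, qPoch_succ',
      show a * q * (b * q) * q ^ (n + 1) = a * b * q ^ (n + 1 + 1) * q by ring]
    field_simp
    ring

theorem functional_X_pow_self_and_succ {q a b : ℝ} (h : Admissible q a b) (n : ℕ) :
    functional q a b (X ^ n) = (1 - a * b * q ^ (n + 2)) *
        (qPoch (a * q) q n / qPoch (a * b * q ^ 2) q (n + 1)) ∧
      functional q a b (X ^ (n + 1)) = (1 - a * q ^ (n + 1)) *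
        (qPoch (a * q) q n / qPoch (a * b * q ^ 2) q (n + 1)) := by
  have h1 : 1 - a * b * q ^ (n + 2) ≠ 0 := (sub_pos.2 (h.abq_lt_one n)).ne'
  constructor
  · rw [functional_X_pow, qPoch_succ, show a * b * q ^ 2 * q ^ n = a * b * q ^ (n + 2) by ring,
      mul_comm (qPoch _ _ _) (1 - _), ← mul_div_assoc, mul_div_mul_left _ _ h1]
  · rw [functional_X_pow, qPoch_succ (a * q)]
    ring

/-- The moment functional turns the skew operator into a skew-symmetric form. -/
theorem functional_skewOperator_X_pow {q a b : ℝ} (h : Admissible q a b) (i j : ℕ) :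
    functional q a b (X ^ j * skewOperator q a b (X ^ i)) =
      (1 - b * q) * (q ^ i - q ^ j) *
        (qPoch (a * q) q (i + j) / qPoch (a * b * q ^ 2) q (i + j + 1)) := by
  have hq := h.q_pos.ne'
  have ha := h.a_pos.ne'
  obtain ⟨h1, h2⟩ := functional_X_pow_self_and_succ h (i + j)
  rw [skewOperator_X_pow, mul_add, mul_left_comm, mul_left_comm (X ^ j), ← pow_add, ← pow_add,
    map_add, functional_C_mul, functional_C_mul, show j + (i + 1) = i + j + 1 by ring,
    add_comm j i, h1, h2]
  field_simp
  ring

theorem functional_raising_X_pow {q a b : ℝ} (h : Admissible q a b) (i j : ℕ) :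
    functional q a b (X ^ j * raising q a b (X ^ i)) =
      (1 - b * q) * (1 - q ^ j) *
        (qPoch (a * q) q (i + j) / qPoch (a * b * q ^ 2) q (i + j + 1)) := by
  have hq := h.q_pos.ne'
  have ha := h.a_pos.ne'
  obtain ⟨h1, h2⟩ := functional_X_pow_self_and_succ h (i + j)
  rw [raising_X_pow, mul_add, mul_left_comm, mul_left_comm (X ^ j), ← pow_add, ← pow_add,
    map_add, functional_C_mul, functional_C_mul, show j + (i + 1) = i + j + 1 by ring,
    add_comm j i, h1, h2]
  field_simp
  ring

/-- The ratio between the normalisations of the functionals with parameters `(a, b)` and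
`(a * q, b * q)`. -/
noncomputable def shiftFactor (q a b : ℝ) : ℝ :=
  (1 - a * q) * (1 - b * q) / qPoch (a * b * q ^ 2) q 2

theorem Admissible.qPoch_abq_pos {q a b : ℝ} (h : Admissible q a b) (m n : ℕ) :
    0 < qPoch (a * b * q ^ (m + 2)) q n :=
  qPoch_pos (h.abq_lt_one m) h.q_pos h.q_lt_one n

theorem Admissible.shiftFactor_ne_zero {q a b : ℝ} (h : Admissible q a b) :
    shiftFactor q a b ≠ 0 :=
  (div_pos (mul_pos (sub_pos.2 h.aq_lt_one) (sub_pos.2 h.bq_lt_one))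
    (h.qPoch_abq_pos 0 2)).ne'

theorem shiftFactor_mul (q a b : ℝ) (n : ℕ) :
    shiftFactor q a b * (qPoch (a * q ^ 2) q n / qPoch (a * b * q ^ 4) q n) =
      (1 - b * q) * (qPoch (a * q) q (n + 1) / qPoch (a * b * q ^ 2) q (n + 2)) := by
  rw [shiftFactor, add_comm n 2, qPoch_add _ _ 2, qPoch_succ' (a * q), div_mul_div_comm, mul_div_assoc',
    show a * b * q ^ 2 * q ^ 2 = a * b * q ^ 4 by ring, show a * q * q = a * q ^ 2 by ring]
  ring

theorem functional_raising_X_pow_succ {q a b : ℝ} (h : Admissible q a b) (j : ℕ) (f : ℝ[X]) :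
    functional q a b (X ^ (j + 1) * raising q a b f) =
      shiftFactor q a b * (1 - q ^ (j + 1)) *
        functional q (a * q) (b * q) (X ^ j * f) := by
  suffices hS : functional q a b ∘ₗ LinearMap.mulLeft ℝ (X ^ (j + 1)) ∘ₗ raising q a b =
      (shiftFactor q a b * (1 - q ^ (j + 1))) •
        functional q (a * q) (b * q) ∘ₗ LinearMap.mulLeft ℝ (X ^ j) from LinearMap.congr_fun hS f
  refine linearMap_ext_X_pow fun i => ?_
  simp only [LinearMap.comp_apply, LinearMap.mulLeft_apply, LinearMap.smul_apply, smul_eq_mul]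
  rw [functional_raising_X_pow h, ← pow_add, functional_X_pow, mul_right_comm (1 - b * q),
    ← add_assoc, ← shiftFactor_mul, add_comm i j,
    show a * q * (b * q) * q ^ 2 = a * b * q ^ 4 by ring, show a * q * q = a * q ^ 2 by ring]
  ring

theorem functional_raising {q a b : ℝ} (h : Admissible q a b) (f : ℝ[X]) :
    functional q a b (raising q a b f) = 0 := by
  suffices hS : functional q a b ∘ₗ raising q a b = 0 from LinearMap.congr_fun hS f
  refine linearMap_ext_X_pow fun i => ?_
  simpa using functional_raising_X_pow h i 0

theorem functional_X_pow_mul_poly_of_lt {q a b : ℝ} (h : Admissible q a b) {j n : ℕ}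
    (hj : j < n) : functional q a b (X ^ j * poly q n a b) = 0 := by
  induction n generalizing a b j with
  | zero => omega
  | succ n ih =>
    cases j with
    | zero => rw [pow_zero, one_mul, poly, functional_raising h]
    | succ j => rw [poly, functional_raising_X_pow_succ h, ih h.shift (by omega), mul_zero]

theorem functional_X_pow_mul_poly_self {q a b : ℝ} (h : Admissible q a b) (n : ℕ) :
    functional q a b (X ^ n * poly q n a b) =
      qPoch q q n * qPoch (a * q) q n * qPoch (b * q) q n / qPoch (a * b * q ^ 2) q (2 * n) := by
  induction n generalizing a b with
  | zero => simpa [poly, qPoch_zero] using functional_X_pow q a b 0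
  | succ n ih =>
    rw [poly, functional_raising_X_pow_succ h, ih h.shift, shiftFactor, qPoch_succ q,
      qPoch_succ' (a * q), qPoch_succ' (b * q), show 2 * (n + 1) = 2 + 2 * n by ring,
      qPoch_add _ _ 2, show a * q * (b * q) * q ^ 2 = a * b * q ^ 2 * q ^ 2 by ring,
      div_mul_eq_mul_div, div_mul_div_comm]
    ring

theorem functional_mul_poly {q a b : ℝ} (h : Admissible q a b) {n : ℕ} {f : ℝ[X]}
    (hf : f.natDegree ≤ n) : functional q a b (f * poly q n a b) =
      f.coeff n * functional q a b (X ^ n * poly q n a b) := by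
  conv_lhs => rw [f.as_sum_range_C_mul_X_pow' (Nat.lt_succ_of_le hf)]
  rw [Finset.sum_mul, map_sum, Finset.sum_range_succ, Finset.sum_eq_zero, zero_add, mul_assoc,
    functional_C_mul]
  intro i hi
  rw [mul_assoc, functional_C_mul, functional_X_pow_mul_poly_of_lt h (Finset.mem_range.1 hi),
    mul_zero]

theorem functional_mul_skewOperator_eq_sum (q a b : ℝ) {n : ℕ} {f g : ℝ[X]}
    (hf : f.natDegree < n) (hg : g.natDegree < n) :
    functional q a b (g * skewOperator q a b f) =
      ∑ i ∈ Finset.range n, ∑ j ∈ Finset.range n,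
        f.coeff i * functional q a b (X ^ j * skewOperator q a b (X ^ i)) * g.coeff j := by
  conv_lhs => rw [f.as_sum_range_C_mul_X_pow' hf, g.as_sum_range_C_mul_X_pow' hg]
  simp only [C_mul', map_sum, map_smul, Finset.sum_mul, Finset.mul_sum, smul_mul_assoc,
    mul_smul_comm, smul_eq_mul]
  refine Finset.sum_congr rfl fun i _ => Finset.sum_congr rfl fun j _ => ?_
  ring

theorem functional_skewOperator_antisymm {q a b : ℝ} (h : Admissible q a b) (f g : ℝ[X]) :
    functional q a b (f * skewOperator q a b g) = -functional q a b (g * skewOperator q a b f) := by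
  have hf : f.natDegree < f.natDegree + g.natDegree + 1 := by omega
  have hg : g.natDegree < f.natDegree + g.natDegree + 1 := by omega
  rw [functional_mul_skewOperator_eq_sum q a b hg hf,
    functional_mul_skewOperator_eq_sum q a b hf hg, Finset.sum_comm, ← Finset.sum_neg_distrib]
  refine Finset.sum_congr rfl fun i _ => ?_
  rw [← Finset.sum_neg_distrib]
  refine Finset.sum_congr rfl fun j _ => ?_
  rw [functional_skewOperator_X_pow h, functional_skewOperator_X_pow h, add_comm j i]
  ring

/-- The entries of the Pfaffian as values of the moment functional. -/
theorem entry_eq_functional {q a b : ℝ} (h : Admissible q a b) (i j : ℕ) :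
    (qBracket q j - qBracket q i) * (1 - q) * qPoch (a * q ^ 2) q (i + j - 1) /
        qPoch (a * b * q ^ 4) q (i + j - 1) =
      (shiftFactor q a b)⁻¹ * functional q a b (X ^ j * skewOperator q a b (X ^ i)) := by
  have hq : 1 - q ≠ 0 := (sub_pos.2 h.q_lt_one).ne'
  have hbr : (qBracket q j - qBracket q i) * (1 - q) = q ^ i - q ^ j := by
    rw [qBracket, qBracket]
    field_simp
    ring
  rw [functional_skewOperator_X_pow h, hbr]
  rcases Nat.eq_zero_or_pos (i + j) with h0 | h0
  · obtain ⟨rfl, rfl⟩ : i = 0 ∧ j = 0 := by omega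
    simp
  · obtain ⟨n, hn⟩ := Nat.exists_eq_succ_of_ne_zero h0.ne'
    rw [hn, Nat.succ_eq_add_one, Nat.add_sub_cancel, eq_inv_mul_iff_mul_eq₀ h.shiftFactor_ne_zero,
      mul_div_assoc, mul_left_comm, shiftFactor_mul]
    ring

theorem pfaffian_eq_prod {q a b : ℝ} (h : Admissible q a b) (N : ℕ) :
    pfaffian (fun i j : Fin (2 * N) =>
        (qBracket q (j : ℕ) - qBracket q (i : ℕ)) * (1 - q) *
          qPoch (a * q ^ 2) q ((i : ℕ) + (j : ℕ) - 1) /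
          qPoch (a * b * q ^ 4) q ((i : ℕ) + (j : ℕ) - 1)) =
      ∏ k ∈ Finset.range N, (shiftFactor q a b)⁻¹ *
        ((a * q ^ (2 * k + 1))⁻¹ - b * q ^ (2 * k + 1)) *
        functional q a b (X ^ (2 * k + 1) * poly q (2 * k + 1) a b) /
          (poly q (2 * k + 1) a b).coeff (2 * k + 1) := by
  let B : Matrix (Fin (2 * N)) (Fin (2 * N)) ℝ := fun k i => (poly q k a b).coeff i
  let g : ℕ → ℕ → ℝ := fun j k => (shiftFactor q a b)⁻¹ *
    functional q a b (poly q k a b * skewOperator q a b (poly q j a b))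
  have lead_ne (n : ℕ) : (poly q n a b).coeff n ≠ 0 := by
    have hq := h.q_pos
    have ha := h.a_pos
    rw [coeff_poly_self h]
    cases n with
    | zero => simp [qPoch_zero]
    | succ n => exact div_ne_zero (h.qPoch_abq_pos n _).ne' (by positivity)
  have det_B : B.det = ∏ k ∈ Finset.range N,
      (poly q (2 * k) a b).coeff (2 * k) * (poly q (2 * k + 1) a b).coeff (2 * k + 1) := by
    rw [Matrix.det_of_isLowerTriangular, ← Finset.prod_range fun k => (poly q k a b).coeff k]
    · clear B g
      induction N with
      | zero => simp
      | succ N ih =>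
        rw [show 2 * (N + 1) = 2 * N + 1 + 1 by ring, Finset.prod_range_succ,
          Finset.prod_range_succ, ih, Finset.prod_range_succ, mul_assoc]
    · intro i j hij
      exact coeff_eq_zero_of_natDegree_lt ((natDegree_poly_le q _ a b).trans_lt hij)
  have hdet := det_mul_pfaffian_of_tridiagonal (fun i j : Fin (2 * N) =>
        (qBracket q (j : ℕ) - qBracket q (i : ℕ)) * (1 - q) *
          qPoch (a * q ^ 2) q ((i : ℕ) + (j : ℕ) - 1) /
          qPoch (a * b * q ^ 4) q ((i : ℕ) + (j : ℕ) - 1)) B g ?_ ?_ ?_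
  · have det_ne : B.det ≠ 0 :=
      det_B ▸ Finset.prod_ne_zero_iff.2 fun k _ => mul_ne_zero (lead_ne _) (lead_ne _)
    refine mul_left_cancel₀ det_ne (hdet.trans ?_)
    rw [det_B, ← Finset.prod_mul_distrib]
    refine Finset.prod_congr rfl fun k _ => ?_
    have hdeg := natDegree_poly_le q (2 * k) a b
    simp only [g]
    rw [mul_comm (poly q (2 * k + 1) a b), functional_mul_poly h
      ((natDegree_skewOperator_le q a b _).trans (by omega)), coeff_skewOperator,
      coeff_eq_zero_of_natDegree_lt (show _ < 2 * k + 1 by omega)]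
    field_simp [lead_ne (2 * k + 1)]
    ring
  · intro j k
    have hj := (natDegree_poly_le q j a b).trans_lt j.isLt
    have hk := (natDegree_poly_le q k a b).trans_lt k.isLt
    simp only [g, functional_mul_skewOperator_eq_sum q a b hj hk, Finset.sum_range,
      entry_eq_functional h, Finset.mul_sum, Finset.sum_mul, B]
    rw [Finset.sum_comm]
    refine Finset.sum_congr rfl fun _ _ => Finset.sum_congr rfl fun _ _ => ?_
    ring
  · intro j k
    simp only [g]
    rw [functional_skewOperator_antisymm h, mul_neg]
  · intro j k hjk
    have hdeg := natDegree_poly_le q j a b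
    have hdeg' := natDegree_skewOperator_le q a b (poly q j a b)
    simp only [g]
    rw [mul_comm (poly q k a b), functional_mul_poly h (by omega),
      coeff_eq_zero_of_natDegree_lt (by omega), zero_mul, mul_zero]

theorem factor_eq {q a b : ℝ} (h : Admissible q a b) (k : ℕ) :
    (shiftFactor q a b)⁻¹ * ((a * q ^ (2 * k + 1))⁻¹ - b * q ^ (2 * k + 1)) *
        functional q a b (X ^ (2 * k + 1) * poly q (2 * k + 1) a b) /
          (poly q (2 * k + 1) a b).coeff (2 * k + 1) =
      a ^ (2 * k) * q ^ (2 * k * (2 * k + 1)) *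
        (qPoch q q (2 * k + 1) * qPoch (a * q ^ 2) q (2 * k) * qPoch (b * q ^ 2) q (2 * k) /
          ((if k = 0 then (qPoch (a * b * q ^ 2) q 2)⁻¹
              else qPoch (a * b * q ^ 4) q (2 * k - 2)) *
            qPoch (a * b * q ^ (2 * k + 2)) q (2 * k) *
            qPoch (a * b * q ^ (2 * k + 2)) q (2 * k + 2))) := by
  have hq := h.q_pos.ne'
  have ha := h.a_pos.ne'
  have haq := (sub_pos.2 h.aq_lt_one).ne'
  have hbq := (sub_pos.2 h.bq_lt_one).ne'
  have h2 : qPoch (a * b * q ^ 2) q 2 ≠ 0 := (h.qPoch_abq_pos 0 2).ne'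
  have hD : (if k = 0 then (qPoch (a * b * q ^ 2) q 2)⁻¹
      else qPoch (a * b * q ^ 4) q (2 * k - 2)) =
        qPoch (a * b * q ^ 2) q (2 * k) / qPoch (a * b * q ^ 2) q 2 := by
    cases k with
    | zero => simp [qPoch_zero]
    | succ k =>
      rw [if_neg k.succ_ne_zero, show 2 * (k + 1) = 2 + 2 * k by ring, Nat.add_sub_cancel_left,
        qPoch_add _ _ 2, mul_div_cancel_left₀ _ h2,
        show a * b * q ^ 2 * q ^ 2 = a * b * q ^ 4 by ring]
  have h3 : qPoch (a * b * q ^ 2) q (2 * k) ≠ 0 := (h.qPoch_abq_pos 0 _).ne'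
  have h4 : qPoch (a * b * q ^ (2 * k + 2)) q (2 * k) ≠ 0 := (h.qPoch_abq_pos (2 * k) _).ne'
  have h5 : qPoch (a * b * q ^ (2 * k + 2)) q (2 * k + 2) ≠ 0 := (h.qPoch_abq_pos (2 * k) _).ne'
  have h6 : 1 - a * b * q ^ (4 * k + 2) ≠ 0 := (sub_pos.2 (h.abq_lt_one (4 * k))).ne'
  have hdiff : (a * q ^ (2 * k + 1))⁻¹ - b * q ^ (2 * k + 1) =
      (1 - a * b * q ^ (4 * k + 2)) / (a * q ^ (2 * k + 1)) := by
    field_simp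
    ring
  rw [hD, hdiff, functional_X_pow_mul_poly_self h, coeff_poly_self h, shiftFactor,
    qPoch_succ' (a * q), qPoch_succ' (b * q), show 2 * (2 * k + 1) = 2 * k + (2 * k + 2) by ring,
    qPoch_add (a * b * q ^ 2) _ (2 * k), show a * b * q ^ 2 * q ^ (2 * k) = a * b * q ^ (2 * k + 2) by ring,
    show 2 * k + 1 + 1 = 2 * k + 2 by ring, qPoch_succ (a * b * q ^ (2 * k + 2)) q (2 * k),
    show a * b * q ^ (2 * k + 2) * q ^ (2 * k) = a * b * q ^ (4 * k + 2) by ring,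
    show a * q * q = a * q ^ 2 by ring, show b * q * q = b * q ^ 2 by ring]
  generalize 1 - a * b * q ^ (4 * k + 2) = D at *
  generalize 1 - a * q = E at *
  generalize 1 - b * q = F at *
  field_simp
  ring

end LittleQJacobi

theorem rpow_eq_prod {q : ℝ} (hq : 0 < q) (α : ℝ) (N : ℕ) :
    q ^ ((N : ℝ) * ((N : ℝ) - 1) * (4 * (N : ℝ) + 1) / 3 + α * (N : ℝ) * ((N : ℝ) - 1)) =
      ∏ k ∈ Finset.range N, (q ^ α) ^ (2 * k) * q ^ (2 * k * (2 * k + 1)) := by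
  induction N with
  | zero => simp
  | succ N ih =>
    rw [Finset.prod_range_succ, ← ih, ← Real.rpow_natCast (q ^ α), ← Real.rpow_mul hq.le,
      ← Real.rpow_natCast q, ← Real.rpow_add hq, ← Real.rpow_add hq]
    congr 1
    push_cast
    ring

/-- Catalan–Hankel Pfaffian evaluation attached to the little q-Jacobi weight.
For `k = 0` the symbol `(q^{α+β+4};q)_{-2}` is interpreted as `1/((q^{α+β+2};q)_2)`. -/
theorem pfaffian_littleQJacobi (q : ℝ) (hq0 : 0 < q) (hq1 : q < 1)
    (α β : ℝ) (hα : -1 < α) (hβ : -1 < β) (N : ℕ) (hN : 0 < N) :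
    pfaffian (fun i j : Fin (2 * N) =>
        (qBracket q (j : ℕ) - qBracket q (i : ℕ)) * (1 - q) *
          qPoch (q ^ (α + 2)) q ((i : ℕ) + (j : ℕ) - 1) /
          qPoch (q ^ (α + β + 4)) q ((i : ℕ) + (j : ℕ) - 1)) =
      q ^ ((N : ℝ) * ((N : ℝ) - 1) * (4 * (N : ℝ) + 1) / 3 + α * (N : ℝ) * ((N : ℝ) - 1)) *
        ∏ k ∈ Finset.range N,
          qPoch q q (2 * k + 1) * qPoch (q ^ (α + 2)) q (2 * k) * qPoch (q ^ (β + 2)) q (2 * k) /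
            ((if k = 0 then (qPoch (q ^ (α + β + 2)) q 2)⁻¹
                else qPoch (q ^ (α + β + 4)) q (2 * k - 2)) *
              qPoch (q ^ (α + β + 2 * (k : ℝ) + 2)) q (2 * k) *
              qPoch (q ^ (α + β + 2 * (k : ℝ) + 2)) q (2 * k + 2)) := by
  have h : LittleQJacobi.Admissible q (q ^ α) (q ^ β) := by
    refine ⟨hq0, hq1, Real.rpow_pos_of_pos hq0 α, Real.rpow_pos_of_pos hq0 β, ?_, ?_⟩
    · rw [← Real.rpow_add_one hq0.ne']
      exact Real.rpow_lt_one hq0.le hq1 (by linarith)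
    · rw [← Real.rpow_add_one hq0.ne']
      exact Real.rpow_lt_one hq0.le hq1 (by linarith)
  have split_one (x : ℝ) (n : ℕ) : q ^ (x + n) = q ^ x * q ^ n := by
    rw [Real.rpow_add hq0, Real.rpow_natCast]
  have split_two (n : ℕ) : q ^ (α + β + n) = q ^ α * q ^ β * q ^ n := by
    rw [split_one, Real.rpow_add hq0]
  have split_index (k : ℕ) :
      q ^ (α + β + 2 * (k : ℝ) + 2) = q ^ α * q ^ β * q ^ (2 * k + 2) := by
    rw [← split_two]
    push_cast
    ring_nf
  have hα2 : q ^ (α + 2) = q ^ α * q ^ 2 := mod_cast split_one α 2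
  have hβ2 : q ^ (β + 2) = q ^ β * q ^ 2 := mod_cast split_one β 2
  have hαβ2 : q ^ (α + β + 2) = q ^ α * q ^ β * q ^ 2 := mod_cast split_two 2
  have hαβ4 : q ^ (α + β + 4) = q ^ α * q ^ β * q ^ 4 := mod_cast split_two 4
  simp only [hα2, hβ2, hαβ2, hαβ4, split_index]
  rw [LittleQJacobi.pfaffian_eq_prod h, rpow_eq_prod hq0, ← Finset.prod_mul_distrib]
  exact Finset.prod_congr rfl fun k _ => LittleQJacobi.factor_eq h k
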